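/- Let m ∈ (1/2)ℤ_{>0} and s ∈ (1/2)ℤ. If a, b ∈ ℤ have the same parity, or if m ∈ ℤ_{>0} and a, b ∈ ℤ are arbitrary, then for every τ with Im τ > 0 and all z₁, z₂ ∈ ℂ with z₁ ∉ ℤ + ℤτ one has Φ̃^{±[m;s]}(τ, z₁ + aτ, z₂ + bτ) = (±1)^a e^{−2πi m (b z₁ + a z₂)} q^{−mab} Φ̃^{±[m;s]}(τ, z₁, z₂), and Φ̃^{±[m;s]}(τ, z₁ + a, z₂ + b) = e^{2πi s a} Φ̃^{±[m;s]}(τ, z₁, z₂). -/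

import Mathlib

noncomputable section

open Complex

/-- `mexp w = e^{2πi w}`. -/
def mexp (w : ℂ) : ℂ := Complex.exp (2 * (Real.pi : ℂ) * Complex.I * w)

/-- The signed mock theta function `Φ^{sgn[m;s]}(τ,z₁,z₂)`. -/
def PhiS (sgn : ℂ) (m s : ℝ) (τ z₁ z₂ : ℂ) : ℂ :=
  ∑' n : ℤ, sgn ^ n *
    mexp ((m : ℂ) * n * (z₁ + z₂) + (s : ℂ) * z₁ + τ * ((m : ℂ) * n ^ 2 + (s : ℂ) * n)) /
    (1 - mexp (z₁ + n * τ))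

/-- The signed theta function `Θ^{sgn}_{j,m}(τ,z)`. -/
def ThetaS (sgn : ℂ) (j m : ℝ) (τ z : ℂ) : ℂ :=
  ∑' n : ℤ, sgn ^ n *
    mexp ((m : ℂ) * z * ((n : ℂ) + ((j / (2 * m) : ℝ) : ℂ)) +
      τ * (m : ℂ) * ((n : ℂ) + ((j / (2 * m) : ℝ) : ℂ)) ^ 2)

/-- `E(x) = 2∫₀ˣ e^{-πu²} du`. -/
def Efun (x : ℝ) : ℝ := 2 * ∫ u in (0:ℝ)..x, Real.exp (-Real.pi * u ^ 2)

/-- `ψ_{m,n}(τ,z) = (n - 2m Im z / Im τ) √(Im τ / m)`. -/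
def psiMN (m n : ℝ) (τ z : ℂ) : ℝ := (n - 2 * m * z.im / τ.im) * Real.sqrt (τ.im / m)

/-- The real-analytic correction `R^{sgn}_{j,m}(τ,z)`; the summation variable `n ∈ j + 2mℤ`
is written as `n = j + 2mk`, `k ∈ ℤ`, so that `(±1)^{(n-j)/(2m)} = sgn^k`. -/
def RS (sgn : ℂ) (j m : ℝ) (τ z : ℂ) : ℂ :=
  ∑' k : ℤ, sgn ^ k *
    (((Real.sign (j + 2 * m * k - 1 / 2 - j + 2 * m) -
        Efun (psiMN m (j + 2 * m * k) τ z) : ℝ)) : ℂ) *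
    Complex.exp (-(Real.pi : ℂ) * Complex.I * (((j + 2 * m * k : ℝ)) : ℂ) ^ 2 * τ / (2 * (m : ℂ))
      + 2 * (Real.pi : ℂ) * Complex.I * (((j + 2 * m * k : ℝ)) : ℂ) * z)

/-- The modifier `Φ^{sgn[m;s]}_add`; the summation variable `j ∈ s + ℤ`, `s ≤ j < s + 2m`
is written as `j = s + i`, `0 ≤ i < ⌈2m⌉`. -/
def PhiAddS (sgn : ℂ) (m s : ℝ) (τ z₁ z₂ : ℂ) : ℂ :=
  ∑ i ∈ Finset.range ⌈2 * m⌉₊,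
    RS sgn (s + i) m τ ((z₁ - z₂) / 2) * ThetaS sgn (s + i) m τ (z₁ + z₂)

/-- The modified (signed) mock theta function `Φ̃^{sgn[m;s]}`. -/
def PhiTilde (sgn : ℂ) (m s : ℝ) (τ z₁ z₂ : ℂ) : ℂ :=
  PhiS sgn m s τ z₁ z₂ - (1 / 2) * PhiAddS sgn m s τ z₁ z₂

end

noncomputable section

/-- The numerator of the `n`-th term of the mock theta series. -/
def phiNum (sgn : ℂ) (m s : ℝ) (τ z₁ z₂ : ℂ) (n : ℤ) : ℂ :=
  sgn ^ n *
    mexp ((m : ℂ) * n * (z₁ + z₂) + (s : ℂ) * z₁ + τ * ((m : ℂ) * n ^ 2 + (s : ℂ) * n))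

theorem mexp_add (x y : ℂ) : mexp (x + y) = mexp x * mexp y := by
  simp only [mexp, ← Complex.exp_add]; ring_nf

theorem mexp_ne_zero (x : ℂ) : mexp x ≠ 0 := Complex.exp_ne_zero _

theorem mexp_int (k : ℤ) : mexp k = 1 := by
  rw [mexp, Complex.exp_eq_one_iff]; exact ⟨k, by ring⟩

theorem norm_mexp (w : ℂ) : ‖mexp w‖ = Real.exp (-2 * Real.pi * w.im) := by
  rw [mexp, Complex.norm_exp]; simp

theorem one_sub_mexp_ne_zero {τ z : ℂ} (hz : ∀ x y : ℤ, z ≠ (x : ℂ) + (y : ℂ) * τ) (n : ℤ) :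
    1 - mexp (z + n * τ) ≠ 0 := by
  intro h
  have h1 : mexp (z + n * τ) = 1 := (sub_eq_zero.mp h).symm
  rw [mexp, Complex.exp_eq_one_iff] at h1
  obtain ⟨k, hk⟩ := h1
  have h2 : z + n * τ = k := by
    have : (2 * (Real.pi : ℂ) * Complex.I) ≠ 0 := Complex.two_pi_I_ne_zero
    apply mul_left_cancel₀ this
    rw [hk]; ring
  apply hz k (-n)
  rw [← h2]; push_cast; ring

theorem norm_sign_zpow {sgn : ℂ} (hsgn : sgn = 1 ∨ sgn = -1) (n : ℤ) : ‖sgn ^ n‖ = 1 := by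
  rcases hsgn with rfl | rfl <;> simp

theorem sign_zpow_mul_self {sgn : ℂ} (hsgn : sgn = 1 ∨ sgn = -1) (n : ℤ) :
    sgn ^ n * sgn ^ n = 1 := by
  rcases hsgn with rfl | rfl <;> simp [← mul_zpow]

theorem summable_phiNum {sgn : ℂ} (hsgn : sgn = 1 ∨ sgn = -1) {m : ℝ} (hm : 0 < m) (s : ℝ)
    {τ : ℂ} (hτ : 0 < τ.im) (z₁ z₂ : ℂ) : Summable (phiNum sgn m s τ z₁ z₂) := by
  have h : Summable fun n : ℤ ↦ mexp (s * z₁) *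
      jacobiTheta₂_term n (m * (z₁ + z₂) + s * τ) (2 * m * τ) := by
    apply Summable.mul_left
    rw [summable_jacobiTheta₂_term_iff]
    have : (2 * m * τ : ℂ) = ((2 * m : ℝ) : ℂ) * τ := by push_cast; ring
    rw [this, Complex.im_ofReal_mul]
    positivity
  refine Summable.of_norm_bounded h.norm fun n ↦ le_of_eq ?_
  rw [phiNum, norm_mul, norm_sign_zpow hsgn, one_mul, mexp, mexp, jacobiTheta₂_term,
    ← Complex.exp_add]
  ring_nf

theorem norm_mexp_add_int_mul (τ z : ℂ) (n : ℤ) :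
    ‖mexp (z + n * τ)‖ = Real.exp (-2 * Real.pi * z.im + (n : ℝ) * (-(2 * Real.pi * τ.im))) := by
  rw [norm_mexp]; congr 1; simp; ring

theorem summable_phiNum_div {sgn : ℂ} (hsgn : sgn = 1 ∨ sgn = -1) {m : ℝ} (hm : 0 < m) (s : ℝ)
    {τ : ℂ} (hτ : 0 < τ.im) (z₁ z₂ : ℂ) :
    Summable fun n : ℤ ↦ phiNum sgn m s τ z₁ z₂ n / (1 - mexp (z₁ + n * τ)) := by
  have hneg : -(2 * Real.pi * τ.im) < 0 := by have := Real.pi_pos; nlinarith [mul_pos this hτ]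
  refine Summable.of_norm_bounded_eventually ((summable_phiNum hsgn hm s hτ z₁ z₂).norm.mul_right 2)
    ?_
  suffices h : ∀ᶠ n : ℤ in Filter.cofinite, 1 / 2 ≤ ‖1 - mexp (z₁ + n * τ)‖ by
    filter_upwards [h] with n hn
    rw [norm_div, div_le_iff₀ (by linarith)]
    nlinarith [norm_nonneg (phiNum sgn m s τ z₁ z₂ n)]
  rw [Int.cofinite_eq, Filter.eventually_sup]
  constructor
  · have h : Filter.Tendsto (fun n : ℤ ↦ ‖mexp (z₁ + n * τ)‖) Filter.atBot Filter.atTop := by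
      simp only [norm_mexp_add_int_mul]
      exact Real.tendsto_exp_atTop.comp (Filter.tendsto_atTop_add_const_left _ _
        ((tendsto_intCast_atBot_iff.2 Filter.tendsto_id).atBot_mul_const_of_neg hneg))
    filter_upwards [h.eventually_ge_atTop 2] with n hn
    have := norm_sub_norm_le (mexp (z₁ + n * τ)) 1
    rw [norm_sub_rev] at this
    rw [norm_one] at this
    linarith
  · have h : Filter.Tendsto (fun n : ℤ ↦ ‖mexp (z₁ + n * τ)‖) Filter.atTop (nhds 0) := by
      simp only [norm_mexp_add_int_mul]
      exact Real.tendsto_exp_atBot.comp (Filter.tendsto_atBot_add_const_left _ _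
        (tendsto_intCast_atTop_atTop.atTop_mul_const_of_neg hneg))
    filter_upwards [h.eventually_le_const (show (0 : ℝ) < 1 / 2 by norm_num)] with n hn
    have := norm_sub_norm_le 1 (mexp (z₁ + n * τ))
    rw [norm_one] at this
    linarith

theorem phiNum_add_one (sgn : ℂ) (m s : ℝ) (τ z₁ z₂ : ℂ) (n : ℤ) :
    phiNum sgn m (s + 1) τ z₁ z₂ n = phiNum sgn m s τ z₁ z₂ n * mexp (z₁ + n * τ) := by
  rw [phiNum, phiNum, mul_assoc (sgn ^ n), ← mexp_add]; push_cast; ring_nf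

theorem PhiS_add_one {sgn : ℂ} (hsgn : sgn = 1 ∨ sgn = -1) {m : ℝ} (hm : 0 < m) (s : ℝ)
    {τ z₁ : ℂ} (hτ : 0 < τ.im) (hz : ∀ x y : ℤ, z₁ ≠ (x : ℂ) + (y : ℂ) * τ) (z₂ : ℂ) :
    PhiS sgn m (s + 1) τ z₁ z₂ = PhiS sgn m s τ z₁ z₂ - ∑' n, phiNum sgn m s τ z₁ z₂ n := by
  change ∑' n : ℤ, phiNum sgn m (s + 1) τ z₁ z₂ n / (1 - mexp (z₁ + n * τ)) =
    (∑' n : ℤ, phiNum sgn m s τ z₁ z₂ n / (1 - mexp (z₁ + n * τ))) - _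
  rw [← (summable_phiNum_div hsgn hm s hτ z₁ z₂).tsum_sub (summable_phiNum hsgn hm s hτ z₁ z₂)]
  refine tsum_congr fun n ↦ ?_
  have := one_sub_mexp_ne_zero hz n
  rw [phiNum_add_one]
  field_simp
  ring

/-- The factor by which a translation of `(z₁, z₂)` by `(a τ, b τ)` multiplies
the modified mock theta function, up to the sign `sgn ^ a`. -/
def ellipticFactor (m : ℝ) (a b : ℤ) (τ z₁ z₂ : ℂ) : ℂ :=
  mexp (-(m : ℂ) * ((b : ℂ) * z₁ + (a : ℂ) * z₂)) * mexp (τ * (-((m : ℂ) * a * b)))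

theorem phiNum_tau_shift {sgn : ℂ} (hsgn : sgn = 1 ∨ sgn = -1) (m s : ℝ) (τ z₁ z₂ : ℂ)
    (a b n : ℤ) :
    phiNum sgn m s τ (z₁ + a * τ) (z₂ + b * τ) n =
      sgn ^ a * ellipticFactor m a b τ z₁ z₂ *
        phiNum sgn m (s + m * (b - a)) τ z₁ z₂ (n + a) := by
  have hs0 : sgn ≠ 0 := by rcases hsgn with rfl | rfl <;> simp
  have h : sgn ^ n = sgn ^ a * sgn ^ (n + a) := by
    rw [zpow_add₀ hs0, mul_left_comm, sign_zpow_mul_self hsgn, mul_one]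
  rw [phiNum, phiNum, ellipticFactor, h]
  have : ∀ p q A B C D : ℂ, A = B * C * D → p * q * A = p * (B * C) * (q * D) := by
    rintro p q A B C D rfl; ring
  apply this
  rw [← mexp_add, ← mexp_add]
  congr 1
  push_cast
  ring

theorem PhiS_tau_shift {sgn : ℂ} (hsgn : sgn = 1 ∨ sgn = -1) (m s : ℝ) (τ z₁ z₂ : ℂ)
    (a b : ℤ) :
    PhiS sgn m s τ (z₁ + a * τ) (z₂ + b * τ) =
      sgn ^ a * ellipticFactor m a b τ z₁ z₂ * PhiS sgn m (s + m * (b - a)) τ z₁ z₂ := by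
  change ∑' n : ℤ, phiNum sgn m s τ (z₁ + a * τ) (z₂ + b * τ) n /
      (1 - mexp (z₁ + a * τ + n * τ)) = _ *
    (∑' n : ℤ, phiNum sgn m (s + m * (b - a)) τ z₁ z₂ n / (1 - mexp (z₁ + n * τ)))
  rw [← tsum_mul_left, ← (Equiv.addRight a).tsum_eq (fun n : ℤ ↦ sgn ^ a *
    ellipticFactor m a b τ z₁ z₂ *
      (phiNum sgn m (s + m * (b - a)) τ z₁ z₂ n / (1 - mexp (z₁ + n * τ))))]
  refine tsum_congr fun n ↦ ?_
  rw [phiNum_tau_shift hsgn, Equiv.coe_addRight, mul_div_assoc]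
  congr 4
  push_cast
  ring

theorem tsum_phiNum_tau_shift {sgn : ℂ} (hsgn : sgn = 1 ∨ sgn = -1) (m s : ℝ) (τ z₁ z₂ : ℂ)
    (a b : ℤ) :
    ∑' n, phiNum sgn m s τ (z₁ + a * τ) (z₂ + b * τ) n =
      sgn ^ a * ellipticFactor m a b τ z₁ z₂ *
        ∑' n, phiNum sgn m (s + m * (b - a)) τ z₁ z₂ n := by
  rw [← tsum_mul_left, ← (Equiv.addRight a).tsum_eq (fun n : ℤ ↦ sgn ^ a *
    ellipticFactor m a b τ z₁ z₂ * phiNum sgn m (s + m * (b - a)) τ z₁ z₂ n)]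
  exact tsum_congr fun n ↦ phiNum_tau_shift hsgn m s τ z₁ z₂ a b n

theorem phiNum_int_shift (sgn : ℂ) (m s : ℝ) (τ z₁ z₂ : ℂ) (a b n : ℤ)
    (h : ∃ c : ℤ, (c : ℝ) = m * (a + b)) :
    phiNum sgn m s τ (z₁ + a) (z₂ + b) n = mexp (s * a) * phiNum sgn m s τ z₁ z₂ n := by
  obtain ⟨c, hc⟩ := h
  have hc' : (c : ℂ) = m * (a + b) := by exact_mod_cast congrArg Complex.ofReal hc
  have h1 := mexp_int (n * c)
  rw [phiNum, phiNum, mul_left_comm, ← mexp_add, ← mul_one (mexp (s * a + _)), ← h1, ← mexp_add]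
  congr 2
  push_cast
  rw [hc']
  ring

theorem PhiS_int_shift (sgn : ℂ) (m s : ℝ) (τ z₁ z₂ : ℂ) (a b : ℤ)
    (h : ∃ c : ℤ, (c : ℝ) = m * (a + b)) :
    PhiS sgn m s τ (z₁ + a) (z₂ + b) = mexp (s * a) * PhiS sgn m s τ z₁ z₂ := by
  change ∑' n : ℤ, phiNum sgn m s τ (z₁ + a) (z₂ + b) n / (1 - mexp (z₁ + a + n * τ)) = _ *
    (∑' n : ℤ, phiNum sgn m s τ z₁ z₂ n / (1 - mexp (z₁ + n * τ)))
  rw [← tsum_mul_left]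
  refine tsum_congr fun n ↦ ?_
  rw [phiNum_int_shift sgn m s τ z₁ z₂ a b n h, mul_div_assoc,
    show z₁ + a + n * τ = z₁ + n * τ + a by ring, mexp_add (z₁ + n * τ), mexp_int, mul_one]

/-- The sign of `l + 1 / 2`. -/
def stepSign (l : ℤ) : ℝ := if 0 ≤ l then 1 else -1

theorem one_sub_Efun (x : ℝ) :
    1 - Efun x = 2 * ∫ u in Set.Ioi x, Real.exp (-Real.pi * u ^ 2) := by
  have hi := integrable_exp_neg_mul_sq Real.pi_pos
  have h := intervalIntegral.integral_interval_add_Ioi (a := 0) (b := x)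
    hi.integrableOn hi.integrableOn
  rw [integral_gaussian_Ioi, div_self Real.pi_ne_zero, Real.sqrt_one] at h
  rw [Efun]
  linarith

theorem Efun_neg (x : ℝ) : Efun (-x) = -Efun x := by
  have h := intervalIntegral.integral_comp_neg (a := 0) (b := x)
    (fun u ↦ Real.exp (-Real.pi * u ^ 2))
  simp only [neg_sq, neg_zero] at h
  rw [Efun, Efun, intervalIntegral.integral_symm, ← h]
  ring

theorem abs_one_sub_Efun_le {x : ℝ} (hx : 1 ≤ x) :
    |1 - Efun x| ≤ Real.exp (-Real.pi * x ^ 2) := by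
  have hd : ∀ u ∈ Set.Ici x, HasDerivAt (fun u ↦ -Real.exp (-Real.pi * u ^ 2))
      (2 * Real.pi * u * Real.exp (-Real.pi * u ^ 2)) u := by
    intro u _
    have := (((hasDerivAt_pow 2 u).const_mul (-Real.pi)).exp).neg
    refine this.congr_deriv ?_
    push_cast
    ring
  have hlim : Filter.Tendsto (fun u : ℝ ↦ -Real.exp (-Real.pi * u ^ 2)) Filter.atTop (nhds 0) := by
    rw [← neg_zero]
    refine (Real.tendsto_exp_atBot.comp ?_).neg
    exact (Filter.tendsto_pow_atTop two_ne_zero).const_mul_atTop_of_neg (neg_lt_zero.2 Real.pi_pos)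
  have hpos : ∀ u ∈ Set.Ioi x, 0 ≤ 2 * Real.pi * u * Real.exp (-Real.pi * u ^ 2) := by
    intro u hu
    have : 0 < u := by linarith [Set.mem_Ioi.1 hu]
    have := Real.pi_pos
    positivity
  have hint := MeasureTheory.integrableOn_Ioi_deriv_of_nonneg' hd hpos hlim
  have hval := MeasureTheory.integral_Ioi_of_hasDerivAt_of_nonneg' hd hpos hlim
  rw [one_sub_Efun, abs_of_nonneg (by positivity), ← MeasureTheory.integral_const_mul]
  calc _ ≤ ∫ u in Set.Ioi x, 2 * Real.pi * u * Real.exp (-Real.pi * u ^ 2) := by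
        refine MeasureTheory.setIntegral_mono_on
          ((integrable_exp_neg_mul_sq Real.pi_pos).const_mul 2).integrableOn hint
          measurableSet_Ioi fun u hu ↦ ?_
        have hu : x < u := hu
        have hpi := Real.pi_gt_three
        gcongr
        nlinarith
    _ = _ := by rw [hval]; ring

/-- The non-holomorphic coefficient of index `j = s + l` in the modifier. -/
def addCoeff (m s : ℝ) (τ z : ℂ) (l : ℤ) : ℝ :=
  stepSign l - Efun (psiMN m (s + l) τ z)

theorem tendsto_psiMN {m s : ℝ} (hm : 0 < m) {τ z : ℂ} (hτ : 0 < τ.im) :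
    Filter.Tendsto (fun l : ℤ ↦ psiMN m (s + l) τ z) Filter.atTop Filter.atTop ∧
      Filter.Tendsto (fun l : ℤ ↦ psiMN m (s + l) τ z) Filter.atBot Filter.atBot := by
  have hr : 0 < Real.sqrt (τ.im / m) := Real.sqrt_pos.2 (div_pos hτ hm)
  have h : (fun l : ℤ ↦ psiMN m (s + l) τ z) =
      fun l : ℤ ↦ ((s - 2 * m * z.im / τ.im) + (l : ℝ)) * Real.sqrt (τ.im / m) := by
    ext l; rw [psiMN]; ring
  rw [h]
  exact ⟨(Filter.tendsto_atTop_add_const_left _ _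
      tendsto_intCast_atTop_atTop).atTop_mul_const hr,
    (Filter.tendsto_atBot_add_const_left _ _
      (tendsto_intCast_atBot_iff.2 Filter.tendsto_id)).atBot_mul_const hr⟩

theorem abs_addCoeff_le_eventually {m : ℝ} (s : ℝ) (hm : 0 < m) {τ : ℂ} (z : ℂ)
    (hτ : 0 < τ.im) :
    ∀ᶠ l : ℤ in Filter.cofinite,
      |addCoeff m s τ z l| ≤ Real.exp (-Real.pi * psiMN m (s + l) τ z ^ 2) := by
  obtain ⟨h₁, h₂⟩ := tendsto_psiMN (s := s) (z := z) hm hτ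
  rw [Int.cofinite_eq, Filter.eventually_sup]
  constructor
  · filter_upwards [h₂.eventually_le_atBot (-1), Filter.eventually_lt_atBot 0] with l hl hl0
    rw [addCoeff, stepSign, if_neg (by lia)]
    have h := abs_one_sub_Efun_le (x := -psiMN m (s + l) τ z) (by linarith)
    rw [Efun_neg, neg_sq] at h
    rwa [← abs_neg, neg_sub, sub_neg_eq_add, add_comm, ← sub_neg_eq_add]
  · filter_upwards [h₁.eventually_ge_atTop 1, Filter.eventually_ge_atTop 0] with l hl hl0
    rw [addCoeff, stepSign, if_pos hl0]
    exact abs_one_sub_Efun_le hl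

theorem summable_addCoeff_mul_mexp {m : ℝ} (s : ℝ) (hm : 0 < m) {τ : ℂ} (z : ℂ)
    (hτ : 0 < τ.im) :
    Summable fun l : ℤ ↦ (addCoeff m s τ z l : ℂ) *
      mexp (-(τ * ((s + l : ℝ) : ℂ) ^ 2 / (4 * m)) + ((s + l : ℝ) : ℂ) * z) := by
  set T : ℝ := τ.im / (2 * m) with hT
  set c : ℝ := 2 * m * z.im / τ.im with hc
  have hT0 : 0 < T := by positivity
  have hsum := ((summable_jacobiTheta₂_term_iff ((T * (s - c) : ℝ) * Complex.I)
    (T * Complex.I)).2 (by simpa using hT0)).norm.mul_left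
      (Real.exp (-Real.pi * T * (s ^ 2 - 2 * s * c + 2 * c ^ 2)))
  refine Summable.of_norm_bounded_eventually hsum ?_
  filter_upwards [abs_addCoeff_le_eventually s hm z hτ] with l hl
  have hy : τ.im = T * (2 * m) := by rw [hT]; field_simp
  have hz : z.im = c * T := by rw [hc, hT]; field_simp
  have hψ : psiMN m (s + l) τ z ^ 2 = (s + l - c) ^ 2 * (2 * T) := by
    rw [psiMN, mul_pow, Real.sq_sqrt (by positivity), ← hc, hT]; field_simp
  have him : (-(τ * ((s + l : ℝ) : ℂ) ^ 2 / (4 * m)) + ((s + l : ℝ) : ℂ) * z).im =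
      -(T * (s + l) ^ 2 / 2) + (s + l) * (c * T) := by
    have : -(τ * ((s + l : ℝ) : ℂ) ^ 2 / (4 * m)) + ((s + l : ℝ) : ℂ) * z =
      ((-((s + l) ^ 2 / (4 * m)) : ℝ) : ℂ) * τ + ((s + l : ℝ) : ℂ) * z := by push_cast; ring
    rw [this, Complex.add_im, Complex.im_ofReal_mul, Complex.im_ofReal_mul, hy, hz]
    field_simp
    ring
  rw [norm_mul, Complex.norm_real, norm_mexp, him, norm_jacobiTheta₂_term, ← Real.exp_add]
  refine (mul_le_mul_of_nonneg_right hl (Real.exp_pos _).le).trans (le_of_eq ?_)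
  rw [hψ, ← Real.exp_add]
  congr 1
  simp
  ring

theorem tsum_phiNum_eq_ThetaS (sgn : ℂ) {m : ℝ} (hm : 0 < m) (j : ℝ) (τ z₁ z₂ : ℂ) :
    ∑' n, phiNum sgn m j τ z₁ z₂ n =
      mexp (-(τ * (j : ℂ) ^ 2 / (4 * m)) + (j : ℂ) * ((z₁ - z₂) / 2)) *
        ThetaS sgn j m τ (z₁ + z₂) := by
  rw [ThetaS, ← tsum_mul_left]
  refine tsum_congr fun n ↦ ?_
  have hm' : (m : ℂ) ≠ 0 := by exact_mod_cast hm.ne'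
  rw [phiNum, mul_left_comm, ← mexp_add]
  congr 2
  push_cast
  field_simp
  ring

theorem ThetaS_add_period {sgn : ℂ} (hsgn : sgn = 1 ∨ sgn = -1) {m : ℝ} (hm : 0 < m) (j : ℝ)
    (k : ℤ) (τ z : ℂ) :
    ThetaS sgn (j + 2 * m * k) m τ z = sgn ^ k * ThetaS sgn j m τ z := by
  have hs0 : sgn ≠ 0 := by rcases hsgn with rfl | rfl <;> simp
  have hm' : (m : ℂ) ≠ 0 := by exact_mod_cast hm.ne'
  rw [ThetaS, ThetaS, ← (Equiv.addRight k).tsum_eq (fun n : ℤ ↦ sgn ^ n *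
    mexp ((m : ℂ) * z * ((n : ℂ) + ((j / (2 * m) : ℝ) : ℂ)) +
      τ * (m : ℂ) * ((n : ℂ) + ((j / (2 * m) : ℝ) : ℂ)) ^ 2)), ← tsum_mul_left]
  refine tsum_congr fun n ↦ ?_
  rw [Equiv.coe_addRight, zpow_add₀ hs0, ← mul_assoc, mul_left_comm (sgn ^ k),
    sign_zpow_mul_self hsgn, mul_one]
  have : (n : ℂ) + (((j + 2 * m * k) / (2 * m) : ℝ) : ℂ) =
      ((n + k : ℤ) : ℂ) + ((j / (2 * m) : ℝ) : ℂ) := by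
    push_cast; field_simp; ring
  rw [this]

/-- The term of index `j = s + l` in the modifier. -/
def addTerm (sgn : ℂ) (m s : ℝ) (τ z₁ z₂ : ℂ) (l : ℤ) : ℂ :=
  (addCoeff m s τ ((z₁ - z₂) / 2) l : ℂ) * ∑' n, phiNum sgn m (s + l) τ z₁ z₂ n

theorem stepSign_mul_add {M : ℕ} (i : Fin M) (k : ℤ) :
    stepSign (k * M + i) = Real.sign ((M : ℝ) * k - 1 / 2 + M) := by
  have hi : (i : ℤ) < M := by exact_mod_cast i.2
  have hM : (1 : ℝ) ≤ M := by exact_mod_cast (show 1 ≤ M from by have := i.2; lia)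
  rw [stepSign]
  by_cases hk : 0 ≤ k
  · have : (0 : ℝ) ≤ k := by exact_mod_cast hk
    rw [if_pos (by positivity), Real.sign_of_pos (by nlinarith)]
  · have hk' : (k : ℝ) ≤ -1 := by exact_mod_cast (show k ≤ -1 by lia)
    rw [if_neg (by nlinarith), Real.sign_of_neg (by nlinarith)]

theorem half_natCast_pos (M : ℕ) [NeZero M] : (0 : ℝ) < (M : ℝ) / 2 :=
  half_pos (by exact_mod_cast NeZero.pos M)

variable {sgn : ℂ} {M : ℕ}

theorem ThetaS_residue (hsgn : sgn = 1 ∨ sgn = -1) [NeZero M] (s : ℝ)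
    (k : ℤ) (i : Fin M) (τ z : ℂ) :
    ThetaS sgn (s + (k * M + i : ℤ)) ((M : ℝ) / 2) τ z =
      sgn ^ k * ThetaS sgn (s + (i : ℕ)) ((M : ℝ) / 2) τ z := by
  have hm := half_natCast_pos M
  rw [← ThetaS_add_period hsgn hm]
  congr 1
  push_cast
  ring

theorem summable_addTerm (hsgn : sgn = 1 ∨ sgn = -1) [NeZero M] (s : ℝ) {τ : ℂ}
    (hτ : 0 < τ.im) (z₁ z₂ : ℂ) : Summable (addTerm sgn ((M : ℝ) / 2) s τ z₁ z₂) := by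
  have hm := half_natCast_pos M
  refine Summable.of_norm_bounded
    ((summable_addCoeff_mul_mexp s hm ((z₁ - z₂) / 2) hτ).norm.mul_right
      (∑ i : Fin M, ‖ThetaS sgn (s + (i : ℕ)) ((M : ℝ) / 2) τ (z₁ + z₂)‖)) fun l ↦ ?_
  rw [addTerm, tsum_phiNum_eq_ThetaS sgn hm, ← mul_assoc, norm_mul]
  refine mul_le_mul_of_nonneg_left ?_ (norm_nonneg _)
  obtain ⟨⟨k, i⟩, rfl⟩ := (Int.divModEquiv M).symm.surjective l
  rw [Int.divModEquiv_symm_apply, ThetaS_residue hsgn, norm_mul, norm_sign_zpow hsgn, one_mul]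
  exact Finset.single_le_sum
    (f := fun i : Fin M ↦ ‖ThetaS sgn (s + (i : ℕ)) ((M : ℝ) / 2) τ (z₁ + z₂)‖)
    (fun _ _ ↦ norm_nonneg _) (Finset.mem_univ i)

theorem PhiAddS_eq_tsum (hsgn : sgn = 1 ∨ sgn = -1) [NeZero M] (s : ℝ) {τ : ℂ}
    (hτ : 0 < τ.im) (z₁ z₂ : ℂ) :
    PhiAddS sgn ((M : ℝ) / 2) s τ z₁ z₂ = ∑' l, addTerm sgn ((M : ℝ) / 2) s τ z₁ z₂ l := by
  have hm := half_natCast_pos M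
  have hM : 2 * ((M : ℝ) / 2) = M := by ring
  have hM0 : (M : ℂ) ≠ 0 := by exact_mod_cast NeZero.ne M
  have hsum := summable_addTerm hsgn (M := M) s hτ z₁ z₂
  rw [← (Int.divModEquiv M).symm.tsum_eq]
  have hsum' := (Int.divModEquiv M).symm.summable_iff.2 hsum
  rw [← (Equiv.prodComm _ _).tsum_eq]
  have hsum'' := (Equiv.prodComm (Fin M) ℤ).summable_iff.2 hsum'
  rw [Summable.tsum_prod (by exact hsum''), tsum_fintype, PhiAddS, hM, Nat.ceil_natCast,
    Finset.sum_range]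
  refine Finset.sum_congr rfl fun i _ ↦ ?_
  rw [RS, ← tsum_mul_right]
  refine tsum_congr fun k ↦ ?_
  have hj : s + ((k * M + (i : ℕ) : ℤ) : ℝ) = s + (i : ℕ) + 2 * ((M : ℝ) / 2) * k := by
    push_cast; ring
  have hsign : s + (i : ℕ) + 2 * ((M : ℝ) / 2) * k - 1 / 2 - (s + (i : ℕ)) + 2 * ((M : ℝ) / 2) =
    (M : ℝ) * k - 1 / 2 + M := by ring
  simp only [Equiv.prodComm_apply, Prod.swap_prod_mk, Int.divModEquiv_symm_apply]
  rw [addTerm, tsum_phiNum_eq_ThetaS sgn hm, ThetaS_residue hsgn, addCoeff, stepSign_mul_add, hj,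
    hsign, mexp]
  have : ∀ A B C C' D : ℂ, C = C' → A * B * C * D = B * (C' * (A * D)) := by
    rintro A B C _ D rfl; ring
  apply this
  congr 1
  push_cast
  field_simp
  ring

theorem PhiAddS_add_one (hsgn : sgn = 1 ∨ sgn = -1) [NeZero M] (s : ℝ) {τ : ℂ}
    (hτ : 0 < τ.im) (z₁ z₂ : ℂ) :
    PhiAddS sgn ((M : ℝ) / 2) (s + 1) τ z₁ z₂ =
      PhiAddS sgn ((M : ℝ) / 2) s τ z₁ z₂ -
        2 * ∑' n, phiNum sgn ((M : ℝ) / 2) s τ z₁ z₂ n := by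
  have hsum : Summable fun l : ℤ ↦
      addTerm sgn ((M : ℝ) / 2) (s + 1) τ z₁ z₂ (Equiv.subRight (1 : ℤ) l) :=
    (Equiv.subRight (1 : ℤ)).summable_iff.2 (summable_addTerm hsgn (s + 1) hτ z₁ z₂)
  rw [PhiAddS_eq_tsum hsgn _ hτ, PhiAddS_eq_tsum hsgn _ hτ,
    ← (Equiv.subRight (1 : ℤ)).tsum_eq (addTerm sgn ((M : ℝ) / 2) (s + 1) τ z₁ z₂),
    eq_sub_iff_add_eq, ← eq_sub_iff_add_eq',
    ← Summable.tsum_sub (summable_addTerm hsgn s hτ z₁ z₂) hsum,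
    eq_comm, tsum_eq_single 0]
  · simp [addTerm, addCoeff, stepSign]
    ring
  · intro l hl
    have h1 : s + 1 + ((l - 1 : ℤ) : ℝ) = s + l := by push_cast; ring
    have h2 : stepSign (l - 1) = stepSign l := by
      simp only [stepSign]
      congr 1
      rw [eq_iff_iff]
      lia
    simp only [Equiv.subRight_apply, addTerm, addCoeff, h1, h2, sub_self]

theorem PhiTilde_add_one (hsgn : sgn = 1 ∨ sgn = -1) [NeZero M] (s : ℝ) {τ z₁ : ℂ}
    (hτ : 0 < τ.im) (hz : ∀ x y : ℤ, z₁ ≠ (x : ℂ) + (y : ℂ) * τ) (z₂ : ℂ) :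
    PhiTilde sgn ((M : ℝ) / 2) (s + 1) τ z₁ z₂ = PhiTilde sgn ((M : ℝ) / 2) s τ z₁ z₂ := by
  have hm := half_natCast_pos M
  rw [PhiTilde, PhiTilde, PhiAddS_add_one hsgn s hτ, PhiS_add_one hsgn hm s hτ hz]
  ring

theorem PhiTilde_add_int (hsgn : sgn = 1 ∨ sgn = -1) [NeZero M] (s : ℝ) {τ z₁ : ℂ}
    (hτ : 0 < τ.im) (hz : ∀ x y : ℤ, z₁ ≠ (x : ℂ) + (y : ℂ) * τ) (z₂ : ℂ) (d : ℤ) :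
    PhiTilde sgn ((M : ℝ) / 2) (s + d) τ z₁ z₂ = PhiTilde sgn ((M : ℝ) / 2) s τ z₁ z₂ := by
  induction d using Int.induction_on with
  | zero => simp
  | succ i ih =>
    rw [← ih, ← PhiTilde_add_one hsgn (s + (i : ℤ)) hτ hz]; push_cast; rw [add_assoc]
  | pred i ih =>
    rw [← ih, ← PhiTilde_add_one hsgn _ hτ hz]; push_cast; congr 1; ring

theorem PhiAddS_tau_shift (hsgn : sgn = 1 ∨ sgn = -1) [NeZero M] (s : ℝ) {τ : ℂ}
    (hτ : 0 < τ.im) (z₁ z₂ : ℂ) (a b : ℤ) :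
    PhiAddS sgn ((M : ℝ) / 2) s τ (z₁ + a * τ) (z₂ + b * τ) =
      sgn ^ a * ellipticFactor ((M : ℝ) / 2) a b τ z₁ z₂ *
        PhiAddS sgn ((M : ℝ) / 2) (s + (M : ℝ) / 2 * (b - a)) τ z₁ z₂ := by
  rw [PhiAddS_eq_tsum hsgn _ hτ, PhiAddS_eq_tsum hsgn _ hτ, ← tsum_mul_left]
  refine tsum_congr fun l ↦ ?_
  have him : ((z₁ + a * τ - (z₂ + b * τ)) / 2).im = ((z₁ - z₂) / 2).im + (a - b) / 2 * τ.im := by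
    have : (z₁ + a * τ - (z₂ + b * τ)) / 2 = (z₁ - z₂) / 2 + (((a - b) / 2 : ℝ) : ℂ) * τ := by
      push_cast; ring
    rw [this, Complex.add_im, Complex.im_ofReal_mul]
  have hcoeff : addCoeff ((M : ℝ) / 2) s τ ((z₁ + a * τ - (z₂ + b * τ)) / 2) l =
      addCoeff ((M : ℝ) / 2) (s + (M : ℝ) / 2 * (b - a)) τ ((z₁ - z₂) / 2) l := by
    rw [addCoeff, addCoeff, psiMN, psiMN, him]
    congr 3
    field_simp
    ring
  rw [addTerm, addTerm, hcoeff, tsum_phiNum_tau_shift hsgn, mul_left_comm, add_right_comm]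

theorem PhiTilde_tau_shift (hsgn : sgn = 1 ∨ sgn = -1) [NeZero M] (s : ℝ) {τ : ℂ}
    (hτ : 0 < τ.im) (z₁ z₂ : ℂ) (a b : ℤ) :
    PhiTilde sgn ((M : ℝ) / 2) s τ (z₁ + a * τ) (z₂ + b * τ) =
      sgn ^ a * ellipticFactor ((M : ℝ) / 2) a b τ z₁ z₂ *
        PhiTilde sgn ((M : ℝ) / 2) (s + (M : ℝ) / 2 * (b - a)) τ z₁ z₂ := by
  rw [PhiTilde, PhiTilde, PhiAddS_tau_shift hsgn s hτ, PhiS_tau_shift hsgn]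
  ring

theorem PhiTilde_int_shift (hsgn : sgn = 1 ∨ sgn = -1) [NeZero M] (s : ℝ) {τ : ℂ}
    (hτ : 0 < τ.im) (z₁ z₂ : ℂ) (a b : ℤ) (h : ∃ c : ℤ, (c : ℝ) = (M : ℝ) / 2 * (a + b)) :
    PhiTilde sgn ((M : ℝ) / 2) s τ (z₁ + a) (z₂ + b) =
      mexp (s * a) * PhiTilde sgn ((M : ℝ) / 2) s τ z₁ z₂ := by
  have hadd : PhiAddS sgn ((M : ℝ) / 2) s τ (z₁ + a) (z₂ + b) =
      mexp (s * a) * PhiAddS sgn ((M : ℝ) / 2) s τ z₁ z₂ := by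
    rw [PhiAddS_eq_tsum hsgn _ hτ, PhiAddS_eq_tsum hsgn _ hτ, ← tsum_mul_left]
    refine tsum_congr fun l ↦ ?_
    have him : ((z₁ + a - (z₂ + b)) / 2).im = ((z₁ - z₂) / 2).im := by
      have : (z₁ + a - (z₂ + b)) / 2 = (z₁ - z₂) / 2 + (((a - b) / 2 : ℝ) : ℂ) := by
        push_cast; ring
      rw [this, Complex.add_im, Complex.ofReal_im, add_zero]
    have hexp : mexp (((s + l : ℝ) : ℂ) * a) = mexp (s * a) := by
      have : ((s + l : ℝ) : ℂ) * a = s * a + ((l * a : ℤ) : ℂ) := by push_cast; ring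
      rw [this, mexp_add, mexp_int, mul_one]
    simp only [addTerm, addCoeff, psiMN, him, phiNum_int_shift sgn _ _ τ z₁ z₂ a b _ h, hexp,
      tsum_mul_left]
    ring
  rw [PhiTilde, PhiTilde, hadd, PhiS_int_shift sgn _ s τ z₁ z₂ a b h]
  ring

end

/-- elliptic transformations of `Φ̃^{±[m;s]}`, `m = m2/2 ∈ (1/2)ℤ_{>0}`,
`s = s2/2 ∈ (1/2)ℤ`, under the hypothesis that `a, b ∈ ℤ` have the same parity, or
that `m ∈ ℤ_{>0}` (i.e. `m2` is even) and `a, b ∈ ℤ` are arbitrary.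
Here `q^{-mab} = mexp (τ * (-(m*a*b)))`. -/
theorem stmt6 (m2 : ℤ) (hm2 : 0 < m2) (s2 : ℤ) (sgn : ℂ) (hsgn : sgn = 1 ∨ sgn = -1)
    (a b : ℤ) (hab : a % 2 = b % 2 ∨ Even m2)
    (τ z₁ z₂ : ℂ) (hτ : 0 < τ.im) (hz : ∀ x y : ℤ, z₁ ≠ (x : ℂ) + (y : ℂ) * τ) :
    PhiTilde sgn ((m2 : ℝ) / 2) ((s2 : ℝ) / 2) τ (z₁ + a * τ) (z₂ + b * τ) =
      sgn ^ a * mexp (-((m2 : ℂ) / 2) * ((b : ℂ) * z₁ + (a : ℂ) * z₂)) *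
        mexp (τ * (-((m2 : ℂ) / 2 * a * b))) *
        PhiTilde sgn ((m2 : ℝ) / 2) ((s2 : ℝ) / 2) τ z₁ z₂ ∧
    PhiTilde sgn ((m2 : ℝ) / 2) ((s2 : ℝ) / 2) τ (z₁ + a) (z₂ + b) =
      mexp ((s2 : ℂ) / 2 * a) * PhiTilde sgn ((m2 : ℝ) / 2) ((s2 : ℝ) / 2) τ z₁ z₂ := by
  lift m2 to ℕ using hm2.le
  have : NeZero m2 := ⟨by lia⟩
  have hdiv : ∀ c : ℤ, (c % 2 = 0 ∨ Even (m2 : ℤ)) → ∃ d : ℤ, (d : ℝ) = (m2 : ℝ) / 2 * c := by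
    rintro c (hc | ⟨r, hr⟩)
    · obtain ⟨e, rfl⟩ := Int.dvd_of_emod_eq_zero hc
      exact ⟨m2 * e, by push_cast; ring⟩
    · have hr' : (m2 : ℝ) = r + r := by exact_mod_cast hr
      exact ⟨r * c, by rw [hr']; push_cast; ring⟩
  simp only [Int.cast_natCast]
  constructor
  · obtain ⟨d, hd⟩ := hdiv (b - a) (hab.imp_left fun h ↦ by lia)
    push_cast at hd
    rw [PhiTilde_tau_shift hsgn _ hτ, ← hd, PhiTilde_add_int hsgn _ hτ hz, ellipticFactor]
    push_cast
    ring
  · obtain ⟨d, hd⟩ := hdiv (a + b) (hab.imp_left fun h ↦ by lia)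
    push_cast at hd
    rw [PhiTilde_int_shift hsgn _ hτ z₁ z₂ a b ⟨d, hd⟩]
    push_cast
    ring
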